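/- Let A ∈ ℝ^{n×n}, B ∈ ℝ^n, θ_r ∈ ℝ^p, let P ∈ ℝ^{n×n} be symmetric positive definite with Q := P − AᵀPA positive definite, let β > 0, and let c_β := BᵀPB + (1/(β λ_min(Q))) BᵀPA AᵀP B. Let f : ℝ^{p+n} → ℝ be a scalar-output feedforward neural network f(z) = W_{L+1} α_L( ⋯ α_1(W_1 z + b_1) ⋯ ) + b_{L+1} with weights W_l, biases b_l, and componentwise 1-Lipschitz activation functions α_l, satisfying f(0) = 0. Write the row vector Kᵀ := |W_{L+1}| |W_L| ⋯ |W_1| ∈ ℝ^{1×(p+n)} (entrywise absolute values) and let K_u ∈ ℝ^n be the vector of its last n entries. If K_uᵀ K_u < (1 − β) λ_min(Q) / c_β, then there exist constants c₁ > 0 and c₂ ≥ 0 such that for all x ∈ ℝ^n and r ∈ ℝ^p, writing x⁺ := A x + B (θ_rᵀ r + f(r, x)): x⁺ᵀ P x⁺ − xᵀ P x ≤ −c₁ ‖x‖₂² + c₂ ‖r‖₂²; i.e., V(x) = xᵀPx is an ISS-Lyapunov function for the PGNN feedforward controller with these weights. -/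

import Mathlib

open Matrix Finset

/-- The hidden part of a feedforward neural network: `netHidden nd W b a l x` is
the output of layer `l` (dimension `nd l`), obtained from the input `x ∈ ℝ^{nd 0}`
by alternating affine maps `z ↦ W l *ᵥ z + b l` and componentwise activation
layers `a l`. -/
def netHidden (nd : ℕ → ℕ)
    (W : ∀ l : ℕ, Matrix (Fin (nd (l + 1))) (Fin (nd l)) ℝ)
    (b : ∀ l : ℕ, Fin (nd (l + 1)) → ℝ)
    (a : ∀ l : ℕ, Fin (nd (l + 1)) → ℝ → ℝ) :
    (l : ℕ) → (Fin (nd 0) → ℝ) → (Fin (nd l) → ℝ)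
  | 0 => fun x => x
  | (l + 1) => fun x i => a l i (((W l).mulVec (netHidden nd W b a l x) + b l) i)

/-- `absWeightProd nd W l = |W l| * ⋯ * |W 1|` : the product of the entrywise
absolute values of the first `l` weight matrices. -/
def absWeightProd (nd : ℕ → ℕ)
    (W : ∀ l : ℕ, Matrix (Fin (nd (l + 1))) (Fin (nd l)) ℝ) :
    (l : ℕ) → Matrix (Fin (nd l)) (Fin (nd 0)) ℝ
  | 0 => 1
  | (l + 1) => (Matrix.of fun i j => |W l i j|) * absWeightProd nd W l

theorem abs_dotProduct_le_abs_dotProduct_abs {ι : Type*} [Fintype ι] (u v : ι → ℝ) :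
    |u ⬝ᵥ v| ≤ (fun i => |u i|) ⬝ᵥ fun i => |v i| := by
  simpa only [dotProduct, abs_mul] using Finset.abs_sum_le_sum_abs (fun i => u i * v i) univ

/-- The entrywise product of absolute weights is a componentwise Lipschitz bound for the
hidden layers. -/
theorem abs_netHidden_sub_le (nd : ℕ → ℕ)
    (W : ∀ l : ℕ, Matrix (Fin (nd (l + 1))) (Fin (nd l)) ℝ)
    (b : ∀ l : ℕ, Fin (nd (l + 1)) → ℝ)
    (a : ∀ l : ℕ, Fin (nd (l + 1)) → ℝ → ℝ) (L : ℕ)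
    (ha : ∀ l, l < L → ∀ i, LipschitzWith 1 (a l i)) (x y : Fin (nd 0) → ℝ)
    (i : Fin (nd L)) :
    |netHidden nd W b a L x i - netHidden nd W b a L y i|
      ≤ (absWeightProd nd W L *ᵥ fun j => |x j - y j|) i := by
  induction L with
  | zero => simp [netHidden, absWeightProd]
  | succ l ih =>
    replace ih := ih fun k hk => ha k (hk.trans l.lt_succ_self)
    set hx := netHidden nd W b a l x
    set hy := netHidden nd W b a l y
    calc |netHidden nd W b a (l + 1) x i - netHidden nd W b a (l + 1) y i|
        ≤ |(W l *ᵥ hx + b l) i - (W l *ᵥ hy + b l) i| := by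
          simpa [Real.dist_eq, netHidden, hx, hy] using
            (ha l l.lt_succ_self i).dist_le_mul ((W l *ᵥ hx + b l) i) ((W l *ᵥ hy + b l) i)
      _ = |W l i ⬝ᵥ (hx - hy)| := by
          simp [mulVec, dotProduct_sub]
      _ ≤ (fun j => |W l i j|) ⬝ᵥ fun j => |(hx - hy) j| :=
          abs_dotProduct_le_abs_dotProduct_abs _ _
      _ ≤ (fun j => |W l i j|) ⬝ᵥ (absWeightProd nd W l *ᵥ fun j => |x j - y j|) :=
          Finset.sum_le_sum fun j _ => mul_le_mul_of_nonneg_left (ih j) (abs_nonneg _)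
      _ = (absWeightProd nd W (l + 1) *ᵥ fun j => |x j - y j|) i := by
          rw [absWeightProd, ← mulVec_mulVec]
          rfl

theorem abs_dotProduct_netHidden_sub_le (nd : ℕ → ℕ)
    (W : ∀ l : ℕ, Matrix (Fin (nd (l + 1))) (Fin (nd l)) ℝ)
    (b : ∀ l : ℕ, Fin (nd (l + 1)) → ℝ)
    (a : ∀ l : ℕ, Fin (nd (l + 1)) → ℝ → ℝ) (L : ℕ)
    (ha : ∀ l, l < L → ∀ i, LipschitzWith 1 (a l i)) (w : Fin (nd L) → ℝ)
    (x y : Fin (nd 0) → ℝ) :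
    |w ⬝ᵥ netHidden nd W b a L x - w ⬝ᵥ netHidden nd W b a L y|
      ≤ ((fun j => |w j|) ᵥ* absWeightProd nd W L) ⬝ᵥ fun j => |x j - y j| := by
  rw [← dotProduct_sub, ← dotProduct_mulVec]
  exact (abs_dotProduct_le_abs_dotProduct_abs _ _).trans <|
    Finset.sum_le_sum fun j _ =>
      mul_le_mul_of_nonneg_left (abs_netHidden_sub_le nd W b a L ha x y j) (abs_nonneg _)

open scoped MatrixOrder in
theorem Matrix.IsHermitian.mul_sum_sq_le_dotProduct_mulVec {n : ℕ}
    {Q : Matrix (Fin n) (Fin n) ℝ} (hQ : Q.IsHermitian) {c : ℝ}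
    (hc : ∀ i, c ≤ hQ.eigenvalues i) (x : Fin n → ℝ) :
    c * ∑ i, x i ^ 2 ≤ x ⬝ᵥ Q *ᵥ x := by
  have hle : algebraMap ℝ (Matrix (Fin n) (Fin n) ℝ) c ≤ Q := by
    refine algebraMap_le_of_le_spectrum (fun t ht => ?_) hQ
    rw [hQ.spectrum_real_eq_range_eigenvalues] at ht
    obtain ⟨i, rfl⟩ := ht
    exact hc i
  have h := (Matrix.le_iff.mp hle).dotProduct_mulVec_nonneg x
  rw [Algebra.algebraMap_eq_smul_one, sub_mulVec, dotProduct_sub, smul_mulVec, one_mulVec,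
    dotProduct_smul, star_trivial, smul_eq_mul] at h
  simpa [dotProduct, sq] using sub_nonneg.mp h

theorem dotProduct_mulVec_add_smul {n : ℕ} {P : Matrix (Fin n) (Fin n) ℝ} (hP : Pᵀ = P)
    (u v : Fin n → ℝ) (s : ℝ) :
    (u + s • v) ⬝ᵥ P *ᵥ (u + s • v)
      = u ⬝ᵥ P *ᵥ u + 2 * s * (u ⬝ᵥ P *ᵥ v) + s ^ 2 * (v ⬝ᵥ P *ᵥ v) := by
  have hsymm : v ⬝ᵥ P *ᵥ u = u ⬝ᵥ P *ᵥ v := by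
    rw [dotProduct_mulVec, ← mulVec_transpose, hP, dotProduct_comm]
  simp only [mulVec_add, mulVec_smul, add_dotProduct, dotProduct_add, smul_dotProduct,
    dotProduct_smul, smul_eq_mul, hsymm]
  ring

theorem sq_dotProduct_le {ι : Type*} [Fintype ι] (u v : ι → ℝ) :
    (u ⬝ᵥ v) ^ 2 ≤ (u ⬝ᵥ u) * ∑ i, v i ^ 2 := by
  simpa [dotProduct, sq] using Finset.sum_mul_sq_le_sq_mul_sq univ u v

/-- Decrease of `xᵀPx` along `x⁺ = A x + s B`, with the cross term absorbed by a fraction `β` of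
the decrease of the unforced system. -/
theorem lyapunov_decrease_le {n : ℕ} (A P : Matrix (Fin n) (Fin n) ℝ) (B : Fin n → ℝ)
    (hP : Pᵀ = P) {c β : ℝ} (hc : 0 < c) (hβ : 0 < β) (x : Fin n → ℝ)
    (hQ : c * ∑ i, x i ^ 2 ≤ x ⬝ᵥ (P - Aᵀ * P * A) *ᵥ x) (s : ℝ) :
    (A *ᵥ x + s • B) ⬝ᵥ P *ᵥ (A *ᵥ x + s • B) - x ⬝ᵥ P *ᵥ x
      ≤ -((1 - β) * c) * ∑ i, x i ^ 2
        + (B ⬝ᵥ P *ᵥ B + 1 / (β * c) * (B ⬝ᵥ (P * A * Aᵀ * P) *ᵥ B)) * s ^ 2 := by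
  set v := Aᵀ *ᵥ P *ᵥ B with hv
  have hcross : (A *ᵥ x) ⬝ᵥ P *ᵥ B = v ⬝ᵥ x := by
    rw [hv, mulVec_transpose, ← dotProduct_mulVec, dotProduct_comm]
  have hquad : (A *ᵥ x) ⬝ᵥ P *ᵥ A *ᵥ x = x ⬝ᵥ (Aᵀ * P * A) *ᵥ x := by
    rw [← mulVec_mulVec, ← mulVec_mulVec, dotProduct_mulVec x, vecMul_transpose]
  have hBv : B ⬝ᵥ (P * A * Aᵀ * P) *ᵥ B = v ⬝ᵥ v := by
    rw [← mulVec_mulVec, ← mulVec_mulVec, ← hv, dotProduct_mulVec, ← vecMul_vecMul,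
      ← mulVec_transpose P, hP, ← mulVec_transpose]
  rw [dotProduct_mulVec_add_smul hP, hcross, hquad, hBv]
  rw [sub_mulVec, dotProduct_sub] at hQ
  have hd : 0 < β * c := mul_pos hβ hc
  have hyoung : 2 * s * (v ⬝ᵥ x) ≤ β * c * ∑ i, x i ^ 2 + 1 / (β * c) * (v ⬝ᵥ v) * s ^ 2 := by
    have hterm (i : Fin n) :
        2 * s * (v i * x i) ≤ β * c * x i ^ 2 + 1 / (β * c) * (v i * v i) * s ^ 2 := by
      have hsq : 0 ≤ (β * c * x i - s * v i) ^ 2 / (β * c) := by positivity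
      have heq : (β * c * x i - s * v i) ^ 2 / (β * c)
          = β * c * x i ^ 2 + 1 / (β * c) * (v i * v i) * s ^ 2 - 2 * s * (v i * x i) := by
        field_simp
        ring
      linarith
    have hsum := Finset.sum_le_sum fun i (_ : i ∈ univ) => hterm i
    rwa [← mul_sum, sum_add_distrib, ← mul_sum, ← sum_mul, ← mul_sum] at hsum
  linarith

/-- If `γ k < d`, then a gain `(u + w)²` with `u² ≤ k X` and `w² ≤ M R` is dominated by a
decrease `d X`, up to a multiple of `R`. -/
theorem exists_iss_gain {d γ k M : ℝ} (hγ : 0 ≤ γ) (hk : 0 ≤ k) (hM : 0 ≤ M)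
    (h : γ * k < d) :
    ∃ c₁ > (0 : ℝ), ∃ c₂ ≥ (0 : ℝ), ∀ u w X R : ℝ, 0 ≤ X → u ^ 2 ≤ k * X → w ^ 2 ≤ M * R →
      -d * X + γ * (u + w) ^ 2 ≤ -c₁ * X + c₂ * R := by
  have hg : 0 < d - γ * k := sub_pos.mpr h
  have hγk : 0 ≤ γ * k := mul_nonneg hγ hk
  obtain ⟨ε, hε, hεk⟩ : ∃ ε > 0, ε * (γ * k) ≤ (d - γ * k) / 2 := by
    refine ⟨(d - γ * k) / (2 * (γ * k + 1)), by positivity, ?_⟩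
    rw [div_mul_eq_mul_div, div_le_div_iff₀ (by positivity) two_pos]
    nlinarith
  refine ⟨(d - γ * k) / 2, by positivity, γ * (1 + 1 / ε) * M, by positivity, ?_⟩
  intro u w X R hX hu hw
  have hyoung : (u + w) ^ 2 ≤ (1 + ε) * u ^ 2 + (1 + 1 / ε) * w ^ 2 := by
    have hsq : 0 ≤ (ε * u - w) ^ 2 / ε := by positivity
    have heq : (ε * u - w) ^ 2 / ε
        = (1 + ε) * u ^ 2 + (1 + 1 / ε) * w ^ 2 - (u + w) ^ 2 := by
      field_simp
      ring
    linarith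
  calc -d * X + γ * (u + w) ^ 2
      ≤ -d * X + γ * ((1 + ε) * (k * X) + (1 + 1 / ε) * (M * R)) := by
        gcongr
        exact hyoung.trans (by gcongr)
    _ = -d * X + γ * k * X + ε * (γ * k) * X + γ * (1 + 1 / ε) * M * R := by ring
    _ ≤ -d * X + γ * k * X + (d - γ * k) / 2 * X + γ * (1 + 1 / ε) * M * R := by gcongr
    _ = -((d - γ * k) / 2) * X + γ * (1 + 1 / ε) * M * R := by ring

/-- **Training-imposed ISS of the PGNN feedforward controller** (Lemma 1 of the
paper).  The neural layer is a scalar-output feedforward network on the stacked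
input `z = (r, x) ∈ ℝ^{p+n}`, with componentwise `1`-Lipschitz activations and
`f(0) = 0`.  With `Kᵀ = |W_{L+1}| ⋯ |W_1|` and `K_u` its last `n` entries, the
weight constraint `K_uᵀK_u < (1 − β) λ_min(Q) / c_β` implies that `V(x) = xᵀPx`
is an ISS-Lyapunov function for `x⁺ = A x + B (θ_rᵀ r + f(r, x))`. -/
theorem pgnn_training_imposed_iss {n p : ℕ}
    (A : Matrix (Fin n) (Fin n) ℝ) (B : Fin n → ℝ) (θr : Fin p → ℝ)
    (P : Matrix (Fin n) (Fin n) ℝ) (hP : P.PosDef)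
    (Q : Matrix (Fin n) (Fin n) ℝ) (hQdef : Q = P - Aᵀ * P * A) (hQ : Q.PosDef)
    (lminQ : ℝ) (hlmin : IsLeast (Set.range hQ.1.eigenvalues) lminQ)
    (β : ℝ) (hβ : 0 < β)
    (cβ : ℝ)
    (hcβ : cβ = B ⬝ᵥ P.mulVec B
        + (1 / (β * lminQ)) * (B ⬝ᵥ (P * A * Aᵀ * P).mulVec B))
    (L : ℕ) (hL : 1 ≤ L)
    (nd : ℕ → ℕ) (hnd : ∀ l, 0 < nd l) (hnd0 : nd 0 = p + n)
    (W : ∀ l : ℕ, Matrix (Fin (nd (l + 1))) (Fin (nd l)) ℝ)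
    (b : ∀ l : ℕ, Fin (nd (l + 1)) → ℝ)
    (a : ∀ l : ℕ, Fin (nd (l + 1)) → ℝ → ℝ)
    (ha : ∀ l, l < L → ∀ i, LipschitzWith 1 (a l i))
    (wout : Fin (nd L) → ℝ) (bout : ℝ)
    (f : (Fin (p + n) → ℝ) → ℝ)
    (hf : ∀ z, f z = wout ⬝ᵥ netHidden nd W b a L (fun i => z (Fin.cast hnd0 i)) + bout)
    (hf0 : f 0 = 0)
    (K : Fin (nd 0) → ℝ)
    (hK : K = Matrix.vecMul (fun j => |wout j|) (absWeightProd nd W L))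
    (Ku : Fin n → ℝ) (hKu : ∀ j, Ku j = K (Fin.cast hnd0.symm (Fin.natAdd p j)))
    (hcond : Ku ⬝ᵥ Ku < (1 - β) * lminQ / cβ) :
    ∃ c₁ > (0 : ℝ), ∃ c₂ ≥ (0 : ℝ), ∀ (x : Fin n → ℝ) (r : Fin p → ℝ),
      (A.mulVec x + (θr ⬝ᵥ r + f (Fin.append r x)) • B) ⬝ᵥ
          P.mulVec (A.mulVec x + (θr ⬝ᵥ r + f (Fin.append r x)) • B)
        - x ⬝ᵥ P.mulVec x
      ≤ -c₁ * (∑ i, (x i) ^ 2) + c₂ * (∑ i, (r i) ^ 2) := by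
  have hPt : Pᵀ = P := by simpa using hP.1.eq
  have hlpos : 0 < lminQ := by
    obtain ⟨i, hi⟩ := hlmin.1
    exact hi ▸ hQ.eigenvalues_pos i
  have hKK : 0 ≤ Ku ⬝ᵥ Ku := by simpa using dotProduct_star_self_nonneg Ku
  have hcnonneg : 0 ≤ cβ := by
    have h₁ : 0 ≤ B ⬝ᵥ P *ᵥ B := by simpa using hP.posSemidef.dotProduct_mulVec_nonneg B
    have h₂ : 0 ≤ B ⬝ᵥ (P * A * Aᵀ * P) *ᵥ B := by
      have h := (posSemidef_self_mul_conjTranspose (P * A)).dotProduct_mulVec_nonneg B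
      simpa [hPt, Matrix.mul_assoc] using h
    rw [hcβ]
    positivity
  have hcpos : 0 < cβ := by
    refine hcnonneg.lt_of_ne fun h => ?_
    rw [← h, div_zero] at hcond
    exact hcond.not_ge hKK
  have hgap : cβ * (Ku ⬝ᵥ Ku) < (1 - β) * lminQ := by
    rwa [lt_div_iff₀ hcpos, mul_comm] at hcond
  let Kr : Fin p → ℝ := fun j => |θr j| + K (Fin.cast hnd0.symm (Fin.castAdd n j))
  have hinput (x : Fin n → ℝ) (r : Fin p → ℝ) :
      |θr ⬝ᵥ r + f (Fin.append r x)| ≤ (Ku ⬝ᵥ fun i => |x i|) + Kr ⬝ᵥ fun i => |r i| := by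
    have hnet : |f (Fin.append r x)|
        ≤ K ⬝ᵥ fun i => |Fin.append r x (Fin.cast hnd0 i)| := by
      have h := abs_dotProduct_netHidden_sub_le nd W b a L ha wout
        (fun i => Fin.append r x (Fin.cast hnd0 i)) 0
      have hzero := hf 0
      rw [hf0] at hzero
      have heq : f (Fin.append r x)
          = wout ⬝ᵥ netHidden nd W b a L (fun i => Fin.append r x (Fin.cast hnd0 i))
            - wout ⬝ᵥ netHidden nd W b a L 0 := by
        rw [hf, eq_neg_of_add_eq_zero_right hzero.symm]
        rfl
      rw [heq, hK]
      simpa using h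
    have hsplit : (K ⬝ᵥ fun i => |Fin.append r x (Fin.cast hnd0 i)|)
        = (∑ j, K (Fin.cast hnd0.symm (Fin.castAdd n j)) * |r j|) + Ku ⬝ᵥ fun i => |x i| := by
      have hreindex : (K ⬝ᵥ fun i => |Fin.append r x (Fin.cast hnd0 i)|)
          = ∑ i : Fin (p + n), K (Fin.cast hnd0.symm i) * |Fin.append r x i| :=
        Fintype.sum_equiv (finCongr hnd0) _ _ fun i => by simp
      rw [hreindex, Fin.sum_univ_add]
      simp [dotProduct, hKu]
    have hθ := abs_dotProduct_le_abs_dotProduct_abs θr r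
    have hKr : (Kr ⬝ᵥ fun i => |r i|) = ((fun i => |θr i|) ⬝ᵥ fun i => |r i|)
        + ∑ j, K (Fin.cast hnd0.symm (Fin.castAdd n j)) * |r j| := by
      simp only [Kr, dotProduct, add_mul, sum_add_distrib]
    have := abs_add_le (θr ⬝ᵥ r) (f (Fin.append r x))
    linarith
  obtain ⟨c₁, hc₁, c₂, hc₂, hgain⟩ := exists_iss_gain (M := Kr ⬝ᵥ Kr) hcnonneg hKK
    (by simpa using dotProduct_star_self_nonneg Kr) hgap
  refine ⟨c₁, hc₁, c₂, hc₂, fun x r => ?_⟩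
  have hQx := hQ.1.mul_sum_sq_le_dotProduct_mulVec (fun i => hlmin.2 ⟨i, rfl⟩) x
  rw [hQdef] at hQx
  have hdec := lyapunov_decrease_le A P B hPt hlpos hβ x hQx (θr ⬝ᵥ r + f (Fin.append r x))
  rw [← hcβ] at hdec
  refine hdec.trans (le_trans ?_ (hgain (Ku ⬝ᵥ fun i => |x i|) (Kr ⬝ᵥ fun i => |r i|) _ _
    (by positivity) (by simpa using sq_dotProduct_le Ku fun i => |x i|)
    (by simpa using sq_dotProduct_le Kr fun i => |r i|)))
  have hsq : (θr ⬝ᵥ r + f (Fin.append r x)) ^ 2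
      ≤ ((Ku ⬝ᵥ fun i => |x i|) + Kr ⬝ᵥ fun i => |r i|) ^ 2 :=
    sq_le_sq.mpr ((hinput x r).trans (le_abs_self _))
  gcongr
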